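/- Let α = 1, σ ∈ {−1, +1}, s ≥ 0, T > 0, R > 0 and N ∈ ℕ ∪ {∞}. There is a constant C > 0, depending only on R, T, s, such that for all v, w : ℤ → ℂ with ‖v‖_{H^s} ≤ R and ‖w‖_{H^s} ≤ R, the Birkhoff flows satisfy ‖Φ_t^N(v) − Φ_t^N(w)‖_{H^s} ≤ C ‖v − w‖_{H^s} for all |t| ≤ T. -/

import Mathlib

open scoped BigOperators ENNReal ComplexConjugate Classical
open Filter Set MeasureTheory ComplexConjugate

noncomputable section

/-- `ℝ≥0∞`-valued `H^s` norm of a sequence of Fourier coefficients. -/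
def hsE (s : ℝ) (u : ℤ → ℂ) : ℝ≥0∞ :=
  (∑' n : ℤ, ENNReal.ofReal (1 + |(n : ℝ)| ^ (2 * s)) * (‖u n‖₊ : ℝ≥0∞) ^ 2) ^ ((1:ℝ)/2)

/-- `ℝ≥0∞`-valued `FL^{0,1}` norm. -/
def flE (u : ℤ → ℂ) : ℝ≥0∞ := ∑' n : ℤ, (‖u n‖₊ : ℝ≥0∞)

/-- real-valued `H^s` norm. -/
def hsR (s : ℝ) (u : ℤ → ℂ) : ℝ :=
  Real.sqrt (∑' n : ℤ, (1 + |(n : ℝ)| ^ (2 * s)) * ‖u n‖ ^ 2)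

/-- real-valued `FL^{0,1}` norm. -/
def flR (u : ℤ → ℂ) : ℝ := ∑' n : ℤ, ‖u n‖

/-- The condition `|j| ≤ N` for `N ∈ ℕ ∪ {∞}`. -/
def inBall (N : ℕ∞) (j : ℤ) : Prop := (j.natAbs : ℕ∞) ≤ N

/-- The resonance function `Φ_α`. -/
def res (α : ℝ) (j₁ j₂ j₃ : ℤ) : ℝ :=
  |(j₁ : ℝ)| ^ (2 * α) + |(j₂ : ℝ)| ^ (2 * α) - |(j₃ : ℝ)| ^ (2 * α)
    - |((j₁ + j₂ - j₃ : ℤ) : ℝ)| ^ (2 * α)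

/-- The (truncated) Birkhoff vector field `X_N`. -/
def XB (α σ : ℝ) (N : ℕ∞) (u : ℤ → ℂ) : ℤ → ℂ := fun n =>
  if inBall N n then
    ∑' p : ℤ × ℤ,
      (if inBall N p.1 ∧ inBall N p.2 ∧ inBall N (p.1 + p.2 - n) ∧
          res α p.1 p.2 (p.1 + p.2 - n) ≠ 0 then
        ((-σ / res α p.1 p.2 (p.1 + p.2 - n) : ℝ) : ℂ) *
          (u p.1 * u p.2 * conj (u (p.1 + p.2 - n)))
      else 0)
  else 0

/-- Truncation `Π_N`. -/
def trunc (N : ℕ) (u : ℤ → ℂ) : ℤ → ℂ := fun n => if n.natAbs ≤ N then u n else 0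

/-- Derivative of a curve at `t`, in the `H^s` norm. -/
def HasHsDerivAt (s : ℝ) (u : ℝ → ℤ → ℂ) (d : ℤ → ℂ) (t : ℝ) : Prop :=
  Tendsto (fun h : ℝ => hsE s (fun n => (u (t + h) n - u t n) / (h : ℂ) - d n))
    (nhdsWithin 0 {(0 : ℝ)}ᶜ) (nhds 0)

/-- Derivative of a curve at `t` within a set `A` of times, in the `H^s` norm. -/
def HasHsDerivWithinAt (s : ℝ) (u : ℝ → ℤ → ℂ) (d : ℤ → ℂ) (A : Set ℝ) (t : ℝ) : Prop :=
  Tendsto (fun h : ℝ => hsE s (fun n => (u (t + h) n - u t n) / (h : ℂ) - d n))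
    (nhdsWithin 0 {h : ℝ | t + h ∈ A ∧ h ≠ 0}) (nhds 0)

/-- Continuity of a curve in the `H^s` norm. -/
def ContHs (s : ℝ) (D : ℝ → ℤ → ℂ) : Prop :=
  ∀ t : ℝ, Tendsto (fun t' => hsE s (fun n => D t' n - D t n)) (nhds t) (nhds 0)

/-- Continuity of a curve in the `H^s` norm, on a set of times. -/
def ContHsOn (s : ℝ) (A : Set ℝ) (D : ℝ → ℤ → ℂ) : Prop :=
  ∀ t ∈ A, Tendsto (fun t' => hsE s (fun n => D t' n - D t n)) (nhdsWithin t A) (nhds 0)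

/-- `u` is a global-in-time solution of `d/dt u = X_N(u)`, as a curve in `H^s`. -/
def IsSol (α σ : ℝ) (N : ℕ∞) (s : ℝ) (u : ℝ → ℤ → ℂ) : Prop :=
  ∀ t : ℝ, hsE s (u t) ≠ ⊤ ∧ HasHsDerivAt s u (XB α σ N (u t)) t

/-- `u` solves `d/dt u = X_N(u)` on the set of times `A`, as a curve in `H^s`. -/
def IsSolOn (α σ : ℝ) (N : ℕ∞) (s : ℝ) (A : Set ℝ) (u : ℝ → ℤ → ℂ) : Prop :=
  ∀ t ∈ A, hsE s (u t) ≠ ⊤ ∧ HasHsDerivWithinAt s u (XB α σ N (u t)) A t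

/-- `u` is a global-in-time continuously differentiable solution, as a curve in `H^s`. -/
def IsC1Sol (α σ : ℝ) (N : ℕ∞) (s : ℝ) (u : ℝ → ℤ → ℂ) : Prop :=
  IsSol α σ N s u ∧ ContHs s (fun t => XB α σ N (u t))

/-- `u` is a continuously differentiable solution on the set of times `A`. -/
def IsC1SolOn (α σ : ℝ) (N : ℕ∞) (s : ℝ) (A : Set ℝ) (u : ℝ → ℤ → ℂ) : Prop :=
  IsSolOn α σ N s A u ∧ ContHsOn s A (fun t => XB α σ N (u t))

/-- integer modes in `[-N, N]`. -/
def Ifin (N : ℕ) : Finset ℤ := Finset.Icc (-(N:ℤ)) (N:ℤ)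

/-- The quartic form `‖Π_N u‖⁴_{L⁴}`. -/
def qL4 (N : ℕ) (u : ℤ → ℂ) : ℝ :=
  (∑ j₁ ∈ Ifin N, ∑ j₂ ∈ Ifin N, ∑ j₃ ∈ Ifin N, ∑ j₄ ∈ Ifin N,
    if j₁ + j₂ = j₃ + j₄ then u j₁ * u j₂ * conj (u j₃) * conj (u j₄) else 0).re

/-- `G_N(u)`, the derivative at `t = 0` of the energy along the truncated Birkhoff flow. -/
def GN (α σ : ℝ) (N : ℕ) (u : ℤ → ℂ) : ℝ :=
  -(σ/2) * qL4 N u + σ * (∑ j ∈ Ifin N, ‖u j‖^2)^2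
  + 2 * σ * (∑ n₁ ∈ Ifin N, ∑ n₂ ∈ Ifin N, ∑ m₁ ∈ Ifin N, ∑ m₂ ∈ Ifin N,
      if n₁ + n₂ = m₁ + m₂ then
        XB α σ (N : ℕ∞) (trunc N u) n₁ * u n₂ * conj (u m₁) * conj (u m₂)
      else 0).re

/-! ### Square sums with weights -/

/-- The weighted square sum `∑ W(n) |u(n)|²` with values in `ℝ≥0∞`. -/
def wsq (W : ℤ → ℝ≥0∞) (u : ℤ → ℂ) : ℝ≥0∞ := ∑' n : ℤ, W n * ‖u n‖ₑ ^ 2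

lemma tsum_mul_sq_le {ι : Type*} (f g : ι → ℝ≥0∞) :
    (∑' i, f i * g i) ^ 2 ≤ (∑' i, f i ^ 2) * ∑' i, g i ^ 2 := by
  let _ : MeasurableSpace ι := ⊤
  have h := ENNReal.lintegral_mul_le_Lp_mul_Lq (Measure.count : Measure ι)
    (p := 2) (q := 2) Real.HolderConjugate.two_two
    (measurable_from_top (f := f)).aemeasurable (measurable_from_top (f := g)).aemeasurable
  simp only [lintegral_count, Pi.mul_apply, ENNReal.rpow_two] at h
  calc (∑' i, f i * g i) ^ 2
      ≤ ((∑' i, f i ^ 2) ^ (1 / 2 : ℝ) * (∑' i, g i ^ 2) ^ (1 / 2 : ℝ)) ^ 2 := by gcongr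
    _ = _ := by
      rw [mul_pow, ← ENNReal.rpow_two, ← ENNReal.rpow_two, ← ENNReal.rpow_mul,
        ← ENNReal.rpow_mul]
      norm_num

/-- The constant `∑ k⁻²` over the nonzero integers (using `0⁻¹ = 0`). -/
def invSqSum : ℝ≥0∞ := ∑' k : ℤ, ‖((k : ℝ))⁻¹‖ₑ ^ 2

lemma invSqSum_ne_top : invSqSum ≠ ⊤ := by
  have h : Summable fun k : ℤ => ((k : ℝ)⁻¹) ^ 2 := by
    simpa using (Real.summable_one_div_int_pow (p := 2)).2 (by norm_num)
  have h2 := tsum_enorm_ne_top_iff_summable_norm.2 h.norm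
  simpa only [invSqSum, enorm_pow] using h2

lemma tsum_triple (F G H : ℤ → ℝ≥0∞) :
    ∑' n : ℤ, ∑' p : ℤ × ℤ, F p.1 * G p.2 * H (p.1 + p.2 - n)
      = (∑' n, F n) * (∑' n, G n) * ∑' n, H n := by
  rw [ENNReal.tsum_comm]
  have (p : ℤ × ℤ) : ∑' n : ℤ, F p.1 * G p.2 * H (p.1 + p.2 - n) = F p.1 * G p.2 * ∑' n, H n := by
    rw [ENNReal.tsum_mul_left, ← (Equiv.subLeft (p.1 + p.2)).tsum_eq H]
    rfl
  simp_rw [this]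
  rw [ENNReal.tsum_mul_right, ENNReal.tsum_prod (f := fun a b => F a * G b)]
  simp_rw [ENNReal.tsum_mul_left]
  rw [ENNReal.tsum_mul_right]

/-! ### The trilinear form behind the Birkhoff vector field -/

/-- The coefficient `-σ/Φ₁` of the truncated Birkhoff field, with the truncation included. -/
def birkhoffCoeff (σ : ℝ) (N : ℕ∞) (n j₁ j₂ : ℤ) : ℝ :=
  if inBall N n ∧ inBall N j₁ ∧ inBall N j₂ ∧ inBall N (j₁ + j₂ - n) then
    -σ / res 1 j₁ j₂ (j₁ + j₂ - n) else 0

/-- The trilinear form whose diagonal is the Birkhoff field for `α = 1`. -/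
def birkhoffForm (σ : ℝ) (N : ℕ∞) (a b c : ℤ → ℂ) (n : ℤ) : ℂ :=
  ∑' p : ℤ × ℤ, (birkhoffCoeff σ N n p.1 p.2 : ℂ) * (a p.1 * b p.2 * conj (c (p.1 + p.2 - n)))

lemma XB_eq_birkhoffForm (σ : ℝ) (N : ℕ∞) (u : ℤ → ℂ) :
    XB 1 σ N u = birkhoffForm σ N u u u := by
  funext n
  unfold XB birkhoffForm birkhoffCoeff
  split_ifs with h
  · refine tsum_congr fun p => ?_
    by_cases h0 : res 1 p.1 p.2 (p.1 + p.2 - n) = 0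
    · simp [h0]
    · simp only [h0, h, ne_eq, not_false_eq_true, and_true, true_and]
      split_ifs <;> simp
  · simp [h]

lemma res_one (j₁ j₂ n : ℤ) :
    res 1 j₁ j₂ (j₁ + j₂ - n) = 2 * (((j₁ - n : ℤ) : ℝ) * ((n - j₂ : ℤ) : ℝ)) := by
  simp only [res, mul_one, Real.rpow_two, sq_abs]
  push_cast
  ring

lemma res_one_swap (j₁ j₂ n : ℤ) :
    res 1 n (j₁ + j₂ - n) (n + (j₁ + j₂ - n) - j₁) = -res 1 j₁ j₂ (j₁ + j₂ - n) := by
  rw [res_one, res_one]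
  push_cast
  ring

lemma birkhoffCoeff_swap (σ : ℝ) (N : ℕ∞) (n j₁ j₂ : ℤ) :
    birkhoffCoeff σ N j₁ n (j₁ + j₂ - n) = -birkhoffCoeff σ N n j₁ j₂ := by
  unfold birkhoffCoeff
  rw [res_one_swap, show n + (j₁ + j₂ - n) - j₁ = j₂ by ring]
  by_cases h : inBall N n ∧ inBall N j₁ ∧ inBall N j₂ ∧ inBall N (j₁ + j₂ - n)
  · rw [if_pos h, if_pos (by tauto), div_neg]
  · rw [if_neg h, if_neg (by tauto), neg_zero]

lemma enorm_birkhoffCoeff_le {σ : ℝ} (hσ : σ = 1 ∨ σ = -1) (N : ℕ∞) (n j₁ j₂ : ℤ) :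
    ‖birkhoffCoeff σ N n j₁ j₂‖ₑ
      ≤ ‖(((j₁ - n : ℤ) : ℝ))⁻¹‖ₑ * ‖(((n - j₂ : ℤ) : ℝ))⁻¹‖ₑ := by
  rw [← enorm_mul, enorm_le_iff_norm_le, birkhoffCoeff, ← mul_inv]
  split_ifs
  · have hσ' : |σ| = 1 := by rcases hσ with rfl | rfl <;> simp
    rw [res_one, Real.norm_eq_abs, Real.norm_eq_abs, abs_div, abs_neg, hσ', abs_inv, abs_mul 2,
      one_div, mul_inv]
    have : 0 ≤ |((j₁ - n : ℤ) : ℝ) * ((n - j₂ : ℤ) : ℝ)|⁻¹ := by positivity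
    rw [abs_two]
    linarith
  · rw [norm_zero]
    exact norm_nonneg _

/-- The sum of the absolute values of the terms of `birkhoffForm`. -/
def birkhoffAbs (σ : ℝ) (N : ℕ∞) (a b c : ℤ → ℂ) (n : ℤ) : ℝ≥0∞ :=
  ∑' p : ℤ × ℤ,
    ‖(birkhoffCoeff σ N n p.1 p.2 : ℂ) * (a p.1 * b p.2 * conj (c (p.1 + p.2 - n)))‖ₑ

lemma enorm_birkhoffForm_le (σ : ℝ) (N : ℕ∞) (a b c : ℤ → ℂ) (n : ℤ) :
    ‖birkhoffForm σ N a b c n‖ₑ ≤ birkhoffAbs σ N a b c n :=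
  enorm_tsum_le_tsum_enorm

lemma tsum_coeff_sq (n : ℤ) :
    ∑' p : ℤ × ℤ, (‖(((p.1 - n : ℤ) : ℝ))⁻¹‖ₑ * ‖(((n - p.2 : ℤ) : ℝ))⁻¹‖ₑ) ^ 2
      = invSqSum ^ 2 := by
  simp_rw [mul_pow]
  rw [ENNReal.tsum_prod (f := fun a b =>
    ‖(((a - n : ℤ) : ℝ))⁻¹‖ₑ ^ 2 * ‖(((n - b : ℤ) : ℝ))⁻¹‖ₑ ^ 2)]
  simp_rw [ENNReal.tsum_mul_left]
  rw [ENNReal.tsum_mul_right, sq invSqSum]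
  congr 1
  · exact (Equiv.subRight n).tsum_eq fun k : ℤ => ‖((k : ℝ))⁻¹‖ₑ ^ 2
  · exact (Equiv.subLeft n).tsum_eq fun k : ℤ => ‖((k : ℝ))⁻¹‖ₑ ^ 2

lemma birkhoffAbs_sq_le {σ : ℝ} (hσ : σ = 1 ∨ σ = -1) (N : ℕ∞) (a b c : ℤ → ℂ) (n : ℤ) :
    birkhoffAbs σ N a b c n ^ 2 ≤ invSqSum ^ 2 *
      ∑' p : ℤ × ℤ, ‖a p.1‖ₑ ^ 2 * ‖b p.2‖ₑ ^ 2 * ‖c (p.1 + p.2 - n)‖ₑ ^ 2 := by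
  have h1 : birkhoffAbs σ N a b c n
      ≤ ∑' p : ℤ × ℤ, (‖(((p.1 - n : ℤ) : ℝ))⁻¹‖ₑ * ‖(((n - p.2 : ℤ) : ℝ))⁻¹‖ₑ) *
        (‖a p.1‖ₑ * ‖b p.2‖ₑ * ‖c (p.1 + p.2 - n)‖ₑ) := by
    refine ENNReal.tsum_le_tsum fun p => ?_
    have hc : ‖conj (c (p.1 + p.2 - n))‖ₑ = ‖c (p.1 + p.2 - n)‖ₑ := by
      rw [← ofReal_norm, ← ofReal_norm, RCLike.norm_conj]
    have hr : ‖(birkhoffCoeff σ N n p.1 p.2 : ℂ)‖ₑ = ‖birkhoffCoeff σ N n p.1 p.2‖ₑ := by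
      rw [← ofReal_norm, ← ofReal_norm, Complex.norm_real]
    rw [enorm_mul, enorm_mul, enorm_mul, hc, hr]
    gcongr
    exact enorm_birkhoffCoeff_le hσ N n p.1 p.2
  calc _ ≤ _ := pow_le_pow_left' h1 2
    _ ≤ _ := tsum_mul_sq_le _ _
    _ = _ := by simp_rw [tsum_coeff_sq, mul_pow]

/-- Tame trilinear estimate for a weight that is subadditive along the interactions. -/
lemma wsq_birkhoffForm_le {σ : ℝ} (hσ : σ = 1 ∨ σ = -1) (N : ℕ∞) {W : ℤ → ℝ≥0∞} {A : ℝ≥0∞}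
    (hW : ∀ j₁ j₂ n : ℤ, W n ≤ A * (W j₁ + W j₂ + W (j₁ + j₂ - n))) (a b c : ℤ → ℂ) :
    ∑' n, W n * birkhoffAbs σ N a b c n ^ 2 ≤ invSqSum ^ 2 * A *
      (wsq W a * wsq 1 b * wsq 1 c + wsq 1 a * wsq W b * wsq 1 c
        + wsq 1 a * wsq 1 b * wsq W c) := by
  have h1 (n : ℤ) : W n * birkhoffAbs σ N a b c n ^ 2 ≤ invSqSum ^ 2 * A *
      ((∑' p : ℤ × ℤ, (W p.1 * ‖a p.1‖ₑ ^ 2) * ‖b p.2‖ₑ ^ 2 * ‖c (p.1 + p.2 - n)‖ₑ ^ 2)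
      + (∑' p : ℤ × ℤ, ‖a p.1‖ₑ ^ 2 * (W p.2 * ‖b p.2‖ₑ ^ 2) * ‖c (p.1 + p.2 - n)‖ₑ ^ 2)
      + ∑' p : ℤ × ℤ, ‖a p.1‖ₑ ^ 2 * ‖b p.2‖ₑ ^ 2 *
          (W (p.1 + p.2 - n) * ‖c (p.1 + p.2 - n)‖ₑ ^ 2)) := by
    rw [← ENNReal.tsum_add, ← ENNReal.tsum_add, mul_assoc]
    refine (mul_le_mul_right (birkhoffAbs_sq_le hσ N a b c n) (W n)).trans ?_
    rw [← mul_assoc, mul_comm (W n), mul_assoc]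
    refine mul_le_mul_right ?_ _
    rw [← ENNReal.tsum_mul_left, ← ENNReal.tsum_mul_left]
    refine ENNReal.tsum_le_tsum fun p => ?_
    refine (mul_le_mul_left (hW p.1 p.2 n) _).trans (le_of_eq ?_)
    ring
  refine (ENNReal.tsum_le_tsum h1).trans (le_of_eq ?_)
  rw [ENNReal.tsum_mul_left, ENNReal.tsum_add, ENNReal.tsum_add]
  rw [tsum_triple (fun j => W j * ‖a j‖ₑ ^ 2) (fun j => ‖b j‖ₑ ^ 2) (fun j => ‖c j‖ₑ ^ 2),
    tsum_triple (fun j => ‖a j‖ₑ ^ 2) (fun j => W j * ‖b j‖ₑ ^ 2) (fun j => ‖c j‖ₑ ^ 2),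
    tsum_triple (fun j => ‖a j‖ₑ ^ 2) (fun j => ‖b j‖ₑ ^ 2) (fun j => W j * ‖c j‖ₑ ^ 2)]
  simp [wsq]

lemma wsq_one (u : ℤ → ℂ) : wsq 1 u = ∑' n : ℤ, ‖u n‖ₑ ^ 2 := by simp [wsq]

lemma tsum_birkhoffAbs_sq_ne_top {σ : ℝ} (hσ : σ = 1 ∨ σ = -1) (N : ℕ∞) {a b c : ℤ → ℂ}
    (ha : wsq 1 a ≠ ⊤) (hb : wsq 1 b ≠ ⊤) (hc : wsq 1 c ≠ ⊤) :
    ∑' n, birkhoffAbs σ N a b c n ^ 2 ≠ ⊤ := by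
  have h := wsq_birkhoffForm_le hσ N (W := 1) (A := 1)
    (fun _ _ _ => by
      simp only [Pi.one_apply, one_mul]
      exact le_add_self) a b c
  simp only [Pi.one_apply, one_mul] at h
  refine ne_top_of_le_ne_top ?_ h
  have hS := invSqSum_ne_top
  finiteness

lemma summable_birkhoffForm {σ : ℝ} (hσ : σ = 1 ∨ σ = -1) (N : ℕ∞) {a b c : ℤ → ℂ}
    (ha : wsq 1 a ≠ ⊤) (hb : wsq 1 b ≠ ⊤) (hc : wsq 1 c ≠ ⊤) (n : ℤ) :
    Summable fun p : ℤ × ℤ =>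
      (birkhoffCoeff σ N n p.1 p.2 : ℂ) * (a p.1 * b p.2 * conj (c (p.1 + p.2 - n))) := by
  have h := ENNReal.ne_top_of_tsum_ne_top (tsum_birkhoffAbs_sq_ne_top hσ N ha hb hc) n
  have h2 : birkhoffAbs σ N a b c n ≠ ⊤ := fun h0 => h (by simp [h0])
  exact (tsum_enorm_ne_top_iff_summable_norm.1 h2).of_norm

lemma wsq_one_birkhoffForm_ne_top {σ : ℝ} (hσ : σ = 1 ∨ σ = -1) (N : ℕ∞) {a b c : ℤ → ℂ}
    (ha : wsq 1 a ≠ ⊤) (hb : wsq 1 b ≠ ⊤) (hc : wsq 1 c ≠ ⊤) :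
    wsq 1 (birkhoffForm σ N a b c) ≠ ⊤ := by
  rw [wsq_one]
  refine ne_top_of_le_ne_top (tsum_birkhoffAbs_sq_ne_top hσ N ha hb hc)
    (ENNReal.tsum_le_tsum fun n => ?_)
  exact pow_le_pow_left' (enorm_birkhoffForm_le σ N a b c n) 2

lemma birkhoffForm_sub {σ : ℝ} (hσ : σ = 1 ∨ σ = -1) (N : ℕ∞) {u v : ℤ → ℂ}
    (hu : wsq 1 u ≠ ⊤) (hv : wsq 1 v ≠ ⊤) (huv : wsq 1 (u - v) ≠ ⊤) :
    birkhoffForm σ N u u u - birkhoffForm σ N v v v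
      = birkhoffForm σ N (u - v) u u + birkhoffForm σ N v (u - v) u
        + birkhoffForm σ N v v (u - v) := by
  funext n
  simp only [Pi.sub_apply, Pi.add_apply]
  unfold birkhoffForm
  rw [← (summable_birkhoffForm hσ N hu hu hu n).tsum_sub (summable_birkhoffForm hσ N hv hv hv n),
    ← (summable_birkhoffForm hσ N huv hu hu n).tsum_add (summable_birkhoffForm hσ N hv huv hu n),
    ← ((summable_birkhoffForm hσ N huv hu hu n).add
      (summable_birkhoffForm hσ N hv huv hu n)).tsum_add (summable_birkhoffForm hσ N hv hv huv n)]
  refine tsum_congr fun p => ?_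
  simp only [Pi.sub_apply, map_sub]
  ring

/-- The Birkhoff field is orthogonal to its argument for the real scalar product of `ℓ²`. -/
lemma re_tsum_conj_mul_birkhoffForm {σ : ℝ} (hσ : σ = 1 ∨ σ = -1) (N : ℕ∞) {u : ℤ → ℂ}
    (hu : wsq 1 u ≠ ⊤) : (∑' n, conj (u n) * birkhoffForm σ N u u u n).re = 0 := by
  set F : ℤ × (ℤ × ℤ) → ℂ := fun q => conj (u q.1) * ((birkhoffCoeff σ N q.1 q.2.1 q.2.2 : ℂ) *
    (u q.2.1 * u q.2.2 * conj (u (q.2.1 + q.2.2 - q.1)))) with hF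
  have hsum : Summable F := by
    refine (tsum_enorm_ne_top_iff_summable_norm.1 ?_).of_norm
    rw [ENNReal.tsum_prod']
    have h1 (n : ℤ) : ∑' p : ℤ × ℤ, ‖F (n, p)‖ₑ = ‖conj (u n)‖ₑ * birkhoffAbs σ N u u u n := by
      rw [birkhoffAbs, ← ENNReal.tsum_mul_left]
      exact tsum_congr fun p => enorm_mul _ _
    simp_rw [h1]
    have h2 := tsum_mul_sq_le (fun n => ‖conj (u n)‖ₑ) (birkhoffAbs σ N u u u)
    have hc (n : ℤ) : ‖conj (u n)‖ₑ = ‖u n‖ₑ := by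
      rw [← ofReal_norm, ← ofReal_norm, RCLike.norm_conj]
    simp_rw [hc] at h2 ⊢
    rw [← wsq_one] at h2
    intro h3
    rw [h3, ENNReal.top_pow two_ne_zero, top_le_iff] at h2
    exact ENNReal.mul_ne_top hu (tsum_birkhoffAbs_sq_ne_top hσ N hu hu hu) h2
  have hprod : ∑' n, conj (u n) * birkhoffForm σ N u u u n = ∑' q, F q := by
    rw [hsum.tsum_prod]
    refine tsum_congr fun n => ?_
    rw [birkhoffForm, ← tsum_mul_left]
  have hinv : Function.Involutive fun q : ℤ × (ℤ × ℤ) => (q.2.1, (q.1, q.2.1 + q.2.2 - q.1)) := by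
    rintro ⟨n, j₁, j₂⟩
    simp
  have hswap (q : ℤ × (ℤ × ℤ)) : F (hinv.toPerm _ q) = -conj (F q) := by
    obtain ⟨n, j₁, j₂⟩ := q
    simp only [hF, Function.Involutive.coe_toPerm, birkhoffCoeff_swap, map_mul, Complex.conj_conj,
      Complex.conj_ofReal, show n + (j₁ + j₂ - n) - j₁ = j₂ by ring]
    push_cast
    ring
  have h := (hinv.toPerm _).tsum_eq F
  simp_rw [hswap] at h
  rw [tsum_neg, ← Complex.conj_tsum] at h
  rw [hprod]
  have h' := congrArg Complex.re h
  rw [Complex.neg_re, Complex.conj_re] at h'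
  linarith

/-! ### Weighted curves in the Hilbert space `ℓ²` -/

/-- A sequence as an element of the Hilbert space `ℓ²`, zero if it is not square summable. -/
def toEll (u : ℤ → ℂ) : lp (fun _ : ℤ => ℂ) 2 :=
  if h : Memℓp u 2 then ⟨u, h⟩ else 0

lemma memℓp_two_of_wsq_one_ne_top {u : ℤ → ℂ} (hu : wsq 1 u ≠ ⊤) : Memℓp u 2 := by
  refine memℓp_gen ?_
  have h : ∑' n, ‖u n ^ 2‖ₑ ≠ ⊤ := by simpa [wsq_one] using hu
  simpa using tsum_enorm_ne_top_iff_summable_norm.1 h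

lemma toEll_apply {u : ℤ → ℂ} (hu : wsq 1 u ≠ ⊤) (n : ℤ) : toEll u n = u n := by
  rw [toEll, dif_pos (memℓp_two_of_wsq_one_ne_top hu)]

lemma enorm_sq_lp (x : lp (fun _ : ℤ => ℂ) 2) : ‖x‖ₑ ^ 2 = ∑' n, ‖x n‖ₑ ^ 2 := by
  have h := lp.norm_rpow_eq_tsum (p := 2) (by norm_num) x
  have hs : Summable fun n => ‖x n‖ ^ 2 := by
    simpa using (lp.memℓp x).summable (by norm_num)
  simp only [ENNReal.toReal_ofNat, Real.rpow_two] at h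
  simp_rw [← ofReal_norm, ← ENNReal.ofReal_pow (norm_nonneg _)]
  rw [h, ENNReal.ofReal_tsum_of_nonneg (fun n => by positivity) hs]

lemma enorm_sq_toEll {u : ℤ → ℂ} (hu : wsq 1 u ≠ ⊤) : ‖toEll u‖ₑ ^ 2 = wsq 1 u := by
  rw [enorm_sq_lp, wsq_one]
  simp_rw [toEll_apply hu]

/-- Pointwise multiplication of a sequence by a real weight. -/
def wmul (ω : ℤ → ℝ) (u : ℤ → ℂ) : ℤ → ℂ := fun n => (ω n : ℂ) * u n

lemma wsq_one_wmul (ω : ℤ → ℝ) (u : ℤ → ℂ) :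
    wsq 1 (wmul ω u) = wsq (fun n => ‖ω n‖ₑ ^ 2) u := by
  simp [wsq, wmul, mul_pow, ← ofReal_norm]

lemma wsq_one_wmul_le {ω : ℤ → ℝ} {M : ℝ≥0∞} (hω : ∀ n, ‖ω n‖ₑ ^ 2 ≤ M) (u : ℤ → ℂ) :
    wsq 1 (wmul ω u) ≤ M * wsq 1 u := by
  rw [wsq_one_wmul, wsq_one, ← ENNReal.tsum_mul_left]
  exact ENNReal.tsum_le_tsum fun n => by gcongr; exact hω n

lemma hsE_zero_sq (u : ℤ → ℂ) : hsE 0 u ^ 2 = 2 * wsq 1 u := by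
  rw [hsE, ← ENNReal.rpow_two, ← ENNReal.rpow_mul, wsq_one]
  norm_num
  simp_rw [← enorm_eq_nnnorm]
  rw [ENNReal.tsum_mul_left]

lemma wsq_one_ne_top_of_hsE {u : ℤ → ℂ} (hu : hsE 0 u ≠ ⊤) : wsq 1 u ≠ ⊤ := by
  intro h
  have := hsE_zero_sq u
  rw [h, ENNReal.mul_top two_ne_zero] at this
  exact ENNReal.pow_ne_top hu this

lemma hasDerivAt_toEll_wmul {ω : ℤ → ℝ} {M : ℝ≥0∞} (hM : M ≠ ⊤) (hω : ∀ n, ‖ω n‖ₑ ^ 2 ≤ M)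
    {U : ℝ → ℤ → ℂ} {d : ℤ → ℂ} {t : ℝ} (hU : ∀ t, wsq 1 (U t) ≠ ⊤) (hd : wsq 1 d ≠ ⊤)
    (h : HasHsDerivAt 0 U d t) :
    HasDerivAt (fun t => toEll (wmul ω (U t))) (toEll (wmul ω d)) t := by
  have hfin (u : ℤ → ℂ) (hu : wsq 1 u ≠ ⊤) : wsq 1 (wmul ω u) ≠ ⊤ :=
    ne_top_of_le_ne_top (ENNReal.mul_ne_top hM hu) (wsq_one_wmul_le hω u)
  rw [hasDerivAt_iff_tendsto_slope_zero, tendsto_iff_edist_tendsto_0]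
  have hlim : Tendsto (fun h : ℝ =>
      (M * hsE 0 (fun n => (U (t + h) n - U t n) / (h : ℂ) - d n) ^ 2) ^ (1 / 2 : ℝ))
      (nhdsWithin 0 {(0 : ℝ)}ᶜ) (nhds 0) := by
    have h1 := (ENNReal.continuous_pow 2).tendsto 0 |>.comp h
    have h2 := ENNReal.Tendsto.const_mul h1 (Or.inr hM)
    have h3 := (ENNReal.continuous_rpow_const (y := 1 / 2)).tendsto _ |>.comp h2
    simpa [Function.comp_def] using h3
  refine tendsto_of_tendsto_of_tendsto_of_le_of_le tendsto_const_nhds hlim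
    (fun _ => zero_le) fun h => ?_
  have hle : edist (h⁻¹ • (toEll (wmul ω (U (t + h))) - toEll (wmul ω (U t))))
      (toEll (wmul ω d)) ^ 2
      ≤ M * hsE 0 (fun n => (U (t + h) n - U t n) / (h : ℂ) - d n) ^ 2 := by
    rw [edist_eq_enorm_sub, enorm_sq_lp, hsE_zero_sq]
    calc _ = wsq 1 (wmul ω fun n => (U (t + h) n - U t n) / (h : ℂ) - d n) := by
          rw [wsq_one]
          refine tsum_congr fun n => ?_
          congr 2
          simp only [lp.coeFn_sub, lp.coeFn_smul, Pi.sub_apply, Pi.smul_apply,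
            toEll_apply (hfin _ (hU _)), toEll_apply (hfin _ hd), wmul, Complex.real_smul]
          push_cast
          ring
      _ ≤ M * wsq 1 fun n => (U (t + h) n - U t n) / (h : ℂ) - d n := wsq_one_wmul_le hω _
      _ ≤ _ := by
          gcongr
          exact le_mul_of_one_le_left zero_le one_le_two
  calc _ = (edist (h⁻¹ • (toEll (wmul ω (U (t + h))) - toEll (wmul ω (U t))))
      (toEll (wmul ω d)) ^ 2) ^ (1 / 2 : ℝ) := by
        rw [← ENNReal.rpow_two, ← ENNReal.rpow_mul]
        norm_num
    _ ≤ _ := ENNReal.rpow_le_rpow hle (by norm_num)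

lemma norm_le_mul_exp_of_norm_deriv_le_of_nonneg {E : Type*} [NormedAddCommGroup E]
    [NormedSpace ℝ E] {f f' : ℝ → E} {K T : ℝ} (hf : ∀ t, HasDerivAt f (f' t) t)
    (hb : ∀ t, |t| ≤ T → ‖f' t‖ ≤ K * ‖f t‖) {t : ℝ} (ht0 : 0 ≤ t) (ht : t ≤ T) :
    ‖f t‖ ≤ ‖f 0‖ * Real.exp (K * t) := by
  have h := norm_le_gronwallBound_of_norm_deriv_right_le (f := f) (f' := f') (δ := ‖f 0‖)
    (K := K) (ε := 0) (a := 0) (b := T)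
    (fun x _ => (hf x).continuousAt.continuousWithinAt)
    (fun x _ => (hf x).hasDerivWithinAt) le_rfl
    (fun x hx => by simpa using hb x (abs_le.2 ⟨by linarith [hx.1, hx.2], hx.2.le⟩)) t ⟨ht0, ht⟩
  simpa [gronwallBound_ε0] using h

lemma norm_le_mul_exp_of_norm_deriv_le {E : Type*} [NormedAddCommGroup E]
    [NormedSpace ℝ E] {f f' : ℝ → E} {K T : ℝ} (hK : 0 ≤ K) (hf : ∀ t, HasDerivAt f (f' t) t)
    (hb : ∀ t, |t| ≤ T → ‖f' t‖ ≤ K * ‖f t‖) {t : ℝ} (ht : |t| ≤ T) :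
    ‖f t‖ ≤ ‖f 0‖ * Real.exp (K * T) := by
  have key : ‖f t‖ ≤ ‖f 0‖ * Real.exp (K * |t|) := by
    rcases le_total 0 t with h0 | h0
    · rw [abs_of_nonneg h0] at ht ⊢
      exact norm_le_mul_exp_of_norm_deriv_le_of_nonneg hf hb h0 ht
    · rw [abs_of_nonpos h0] at ht ⊢
      have h := norm_le_mul_exp_of_norm_deriv_le_of_nonneg (f := fun t => f (-t))
        (f' := fun t => -f' (-t)) (K := K) (T := T)
        (fun t => by
          simpa [Function.comp_def] using (hf (-t)).scomp t (hasDerivAt_neg t))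
        (fun t ht => by simpa using hb (-t) (by simpa using ht)) (neg_nonneg.2 h0) ht
      simpa using h
  exact key.trans (by gcongr)

/-- A bounded weight, at least one, that is subadditive along the interactions. -/
structure AdmissibleWeight (ω : ℤ → ℝ) (A : ℝ≥0∞) : Prop where
  one_le : ∀ n, 1 ≤ ‖ω n‖ₑ ^ 2
  bounded : ∃ M : ℝ≥0∞, M ≠ ⊤ ∧ ∀ n, ‖ω n‖ₑ ^ 2 ≤ M
  subadditive : ∀ j₁ j₂ n : ℤ,
    ‖ω n‖ₑ ^ 2 ≤ A * (‖ω j₁‖ₑ ^ 2 + ‖ω j₂‖ₑ ^ 2 + ‖ω (j₁ + j₂ - n)‖ₑ ^ 2)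

namespace AdmissibleWeight

variable {ω : ℤ → ℝ} {A : ℝ≥0∞}

lemma wsq_one_wmul_ne_top (hω : AdmissibleWeight ω A) {u : ℤ → ℂ} (hu : wsq 1 u ≠ ⊤) :
    wsq 1 (wmul ω u) ≠ ⊤ := by
  obtain ⟨M, hM, h⟩ := hω.bounded
  exact ne_top_of_le_ne_top (ENNReal.mul_ne_top hM hu) (wsq_one_wmul_le h u)

lemma ofReal_norm_sq (hω : AdmissibleWeight ω A) {u : ℤ → ℂ} (hu : wsq 1 u ≠ ⊤) :
    ENNReal.ofReal (‖toEll (wmul ω u)‖ ^ 2) = wsq (fun n => ‖ω n‖ₑ ^ 2) u := by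
  rw [← wsq_one_wmul, ← enorm_sq_toEll (hω.wsq_one_wmul_ne_top hu),
    ENNReal.ofReal_pow (norm_nonneg _), ofReal_norm]

lemma norm_toEll_le (hω : AdmissibleWeight ω A) {u : ℤ → ℂ} (hu : wsq 1 u ≠ ⊤) :
    ‖toEll u‖ ≤ ‖toEll (wmul ω u)‖ := by
  refine (sq_le_sq₀ (norm_nonneg _) (norm_nonneg _)).1 ?_
  rw [← ENNReal.ofReal_le_ofReal_iff (by positivity), hω.ofReal_norm_sq hu,
    ENNReal.ofReal_pow (norm_nonneg _), ofReal_norm, enorm_sq_toEll hu]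
  exact ENNReal.tsum_le_tsum fun n => mul_le_mul_left (hω.one_le n) _

lemma norm_sq_birkhoffForm_le (hω : AdmissibleWeight ω A) (hA : A ≠ ⊤) {σ : ℝ}
    (hσ : σ = 1 ∨ σ = -1) (N : ℕ∞) {a b c : ℤ → ℂ}
    (ha : wsq 1 a ≠ ⊤) (hb : wsq 1 b ≠ ⊤) (hc : wsq 1 c ≠ ⊤) :
    ‖toEll (wmul ω (birkhoffForm σ N a b c))‖ ^ 2 ≤ (invSqSum ^ 2 * A).toReal *
      (‖toEll (wmul ω a)‖ ^ 2 * ‖toEll b‖ ^ 2 * ‖toEll c‖ ^ 2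
        + ‖toEll a‖ ^ 2 * ‖toEll (wmul ω b)‖ ^ 2 * ‖toEll c‖ ^ 2
        + ‖toEll a‖ ^ 2 * ‖toEll b‖ ^ 2 * ‖toEll (wmul ω c)‖ ^ 2) := by
  have hS := invSqSum_ne_top
  have hn {u : ℤ → ℂ} (hu : wsq 1 u ≠ ⊤) : ENNReal.ofReal (‖toEll u‖ ^ 2) = wsq 1 u := by
    rw [ENNReal.ofReal_pow (norm_nonneg _), ofReal_norm, enorm_sq_toEll hu]
  rw [← ENNReal.ofReal_le_ofReal_iff (by positivity),
    hω.ofReal_norm_sq (wsq_one_birkhoffForm_ne_top hσ N ha hb hc),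
    ENNReal.ofReal_mul ENNReal.toReal_nonneg, ENNReal.ofReal_toReal (by finiteness),
    ENNReal.ofReal_add (by positivity) (by positivity),
    ENNReal.ofReal_add (by positivity) (by positivity)]
  simp only [ENNReal.ofReal_mul (mul_nonneg (sq_nonneg _) (sq_nonneg _)),
    ENNReal.ofReal_mul (sq_nonneg _), hω.ofReal_norm_sq ha, hω.ofReal_norm_sq hb,
    hω.ofReal_norm_sq hc, hn ha, hn hb, hn hc]
  refine le_trans (ENNReal.tsum_le_tsum fun n => ?_)
    (wsq_birkhoffForm_le hσ N hω.subadditive a b c)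
  gcongr
  exact enorm_birkhoffForm_le σ N a b c n

/-- Trilinear estimate with the same weighted norm on both sides. -/
lemma norm_birkhoffForm_le (hω : AdmissibleWeight ω A) (hA : A ≠ ⊤) {σ : ℝ}
    (hσ : σ = 1 ∨ σ = -1) (N : ℕ∞) {a b c : ℤ → ℂ}
    (ha : wsq 1 a ≠ ⊤) (hb : wsq 1 b ≠ ⊤) (hc : wsq 1 c ≠ ⊤) :
    ‖toEll (wmul ω (birkhoffForm σ N a b c))‖ ≤ √(3 * (invSqSum ^ 2 * A).toReal) *
      (‖toEll (wmul ω a)‖ * ‖toEll (wmul ω b)‖ * ‖toEll (wmul ω c)‖) := by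
  have h := hω.norm_sq_birkhoffForm_le hA hσ N ha hb hc
  refine (sq_le_sq₀ (norm_nonneg _) (by positivity)).1 (h.trans ?_)
  rw [mul_pow, Real.sq_sqrt (by positivity), mul_comm (3 : ℝ), mul_assoc (ENNReal.toReal _)]
  have h1 := hω.norm_toEll_le ha
  have h2 := hω.norm_toEll_le hb
  have h3 := hω.norm_toEll_le hc
  refine mul_le_mul_of_nonneg_left ?_ ENNReal.toReal_nonneg
  set x := ‖toEll (wmul ω a)‖
  set y := ‖toEll (wmul ω b)‖
  set z := ‖toEll (wmul ω c)‖
  calc _ ≤ x ^ 2 * y ^ 2 * z ^ 2 + x ^ 2 * y ^ 2 * z ^ 2 + x ^ 2 * y ^ 2 * z ^ 2 := by gcongr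
    _ = _ := by ring

/-- Estimate for the Birkhoff field, linear in the weighted norm. -/
lemma norm_birkhoffForm_diag_le (hω : AdmissibleWeight ω A) (hA : A ≠ ⊤) {σ : ℝ}
    (hσ : σ = 1 ∨ σ = -1) (N : ℕ∞) {u : ℤ → ℂ} (hu : wsq 1 u ≠ ⊤) :
    ‖toEll (wmul ω (birkhoffForm σ N u u u))‖ ≤
      √(3 * (invSqSum ^ 2 * A).toReal) * ‖toEll u‖ ^ 2 * ‖toEll (wmul ω u)‖ := by
  have h := hω.norm_sq_birkhoffForm_le hA hσ N hu hu hu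
  refine (sq_le_sq₀ (norm_nonneg _) (by positivity)).1 (h.trans (le_of_eq ?_))
  rw [mul_pow, mul_pow, Real.sq_sqrt (by positivity)]
  ring

lemma hasDerivAt (hω : AdmissibleWeight ω A) {σ : ℝ} (hσ : σ = 1 ∨ σ = -1) {N : ℕ∞}
    {U : ℝ → ℤ → ℂ} (hU : IsSol 1 σ N 0 U) (t : ℝ) :
    HasDerivAt (fun t => toEll (wmul ω (U t)))
      (toEll (wmul ω (birkhoffForm σ N (U t) (U t) (U t)))) t := by
  have hf (t : ℝ) : wsq 1 (U t) ≠ ⊤ := wsq_one_ne_top_of_hsE (hU t).1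
  obtain ⟨M, hM, h⟩ := hω.bounded
  have h2 := (hU t).2
  rw [XB_eq_birkhoffForm] at h2
  exact hasDerivAt_toEll_wmul hM h hf (wsq_one_birkhoffForm_ne_top hσ N (hf t) (hf t) (hf t)) h2

end AdmissibleWeight

lemma wmul_one (u : ℤ → ℂ) : wmul 1 u = u := by
  funext n
  simp [wmul]

lemma admissibleWeight_one : AdmissibleWeight 1 1 where
  one_le n := by simp
  bounded := ⟨1, ENNReal.one_ne_top, fun n => by simp⟩
  subadditive j₁ j₂ n := by
    simp only [Pi.one_apply, enorm_one, one_pow, one_mul]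
    exact le_add_self

/-- Conservation of mass along the Birkhoff flow. -/
lemma norm_toEll_sol {σ : ℝ} (hσ : σ = 1 ∨ σ = -1) {N : ℕ∞} {U : ℝ → ℤ → ℂ}
    (hU : IsSol 1 σ N 0 U) (t : ℝ) : ‖toEll (U t)‖ = ‖toEll (U 0)‖ := by
  have hf (t : ℝ) : wsq 1 (U t) ≠ ⊤ := wsq_one_ne_top_of_hsE (hU t).1
  have hd (t : ℝ) : HasDerivAt (fun t => ‖toEll (U t)‖ ^ 2) 0 t := by
    have h := (admissibleWeight_one.hasDerivAt hσ hU t).norm_sq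
    simp only [wmul_one] at h
    convert h using 1
    rw [lp.inner_eq_tsum]
    have hX := wsq_one_birkhoffForm_ne_top hσ N (hf t) (hf t) (hf t)
    have hs : Summable fun n => conj (U t n) * birkhoffForm σ N (U t) (U t) (U t) n := by
      have := lp.summable_inner (𝕜 := ℂ) (toEll (U t))
        (toEll (birkhoffForm σ N (U t) (U t) (U t)))
      simp_rw [toEll_apply (hf t), toEll_apply hX, RCLike.inner_apply'] at this
      exact this
    have h0 := re_tsum_conj_mul_birkhoffForm hσ N (hf t)
    rw [Complex.re_tsum hs] at h0
    simp_rw [toEll_apply (hf t), toEll_apply hX, real_inner_eq_re_inner ℂ, RCLike.inner_apply']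
    exact (mul_eq_zero_of_right _ h0).symm
  have h := is_const_of_deriv_eq_zero (fun t => (hd t).differentiableAt)
    (fun t => (hd t).deriv) t 0
  exact (sq_eq_sq₀ (norm_nonneg _) (norm_nonneg _)).1 h

/-- A priori bound for the weighted norm of a solution. -/
lemma AdmissibleWeight.norm_sol_le {ω : ℤ → ℝ} {A : ℝ≥0∞} (hω : AdmissibleWeight ω A)
    (hA : A ≠ ⊤) {σ : ℝ} (hσ : σ = 1 ∨ σ = -1) {N : ℕ∞} {U : ℝ → ℤ → ℂ} (hU : IsSol 1 σ N 0 U)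
    {R T : ℝ} (hR : ‖toEll (wmul ω (U 0))‖ ≤ R) {t : ℝ} (ht : |t| ≤ T) :
    ‖toEll (wmul ω (U t))‖
      ≤ R * Real.exp (√(3 * (invSqSum ^ 2 * A).toReal) * R ^ 2 * T) := by
  have hf (t : ℝ) : wsq 1 (U t) ≠ ⊤ := wsq_one_ne_top_of_hsE (hU t).1
  refine (norm_le_mul_exp_of_norm_deriv_le (by positivity) (hω.hasDerivAt hσ hU)
    (fun r _ => (hω.norm_birkhoffForm_diag_le hA hσ N (hf r)).trans ?_) ht).trans
    (mul_le_mul_of_nonneg_right hR (Real.exp_pos _).le)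
  rw [norm_toEll_sol hσ hU r]
  gcongr
  exact (hω.norm_toEll_le (hf 0)).trans hR

/-- Lipschitz estimate in a weighted norm for two solutions. -/
lemma AdmissibleWeight.norm_sol_sub_le {ω : ℤ → ℝ} {A : ℝ≥0∞} (hω : AdmissibleWeight ω A)
    (hA : A ≠ ⊤) {σ : ℝ} (hσ : σ = 1 ∨ σ = -1) {N : ℕ∞} {U V : ℝ → ℤ → ℂ}
    (hU : IsSol 1 σ N 0 U) (hV : IsSol 1 σ N 0 V) {B T : ℝ}
    (hBU : ∀ t, |t| ≤ T → ‖toEll (wmul ω (U t))‖ ≤ B)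
    (hBV : ∀ t, |t| ≤ T → ‖toEll (wmul ω (V t))‖ ≤ B)
    (hD : ∀ t, wsq 1 (U t - V t) ≠ ⊤) {t : ℝ} (ht : |t| ≤ T) :
    ‖toEll (wmul ω (U t - V t))‖ ≤ ‖toEll (wmul ω (U 0 - V 0))‖ *
      Real.exp (3 * √(3 * (invSqSum ^ 2 * A).toReal) * B ^ 2 * T) := by
  have hfU (t : ℝ) : wsq 1 (U t) ≠ ⊤ := wsq_one_ne_top_of_hsE (hU t).1
  have hfV (t : ℝ) : wsq 1 (V t) ≠ ⊤ := wsq_one_ne_top_of_hsE (hV t).1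
  have hsub {u v : ℤ → ℂ} (hu : wsq 1 u ≠ ⊤) (hv : wsq 1 v ≠ ⊤) (huv : wsq 1 (u - v) ≠ ⊤) :
      toEll (wmul ω (u - v)) = toEll (wmul ω u) - toEll (wmul ω v) := by
    ext n
    rw [lp.coeFn_sub, Pi.sub_apply, toEll_apply (hω.wsq_one_wmul_ne_top hu),
      toEll_apply (hω.wsq_one_wmul_ne_top hv), toEll_apply (hω.wsq_one_wmul_ne_top huv)]
    simp [wmul, mul_sub]
  have hadd {u v w : ℤ → ℂ} (hu : wsq 1 u ≠ ⊤) (hv : wsq 1 v ≠ ⊤) (hw : wsq 1 w ≠ ⊤)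
      {x : lp (fun _ : ℤ => ℂ) 2} (hx : ∀ n, x n = (ω n : ℂ) * (u + v + w) n) :
      x = toEll (wmul ω u) + toEll (wmul ω v) + toEll (wmul ω w) := by
    ext n
    rw [lp.coeFn_add, lp.coeFn_add, Pi.add_apply, Pi.add_apply,
      toEll_apply (hω.wsq_one_wmul_ne_top hu), toEll_apply (hω.wsq_one_wmul_ne_top hv),
      toEll_apply (hω.wsq_one_wmul_ne_top hw), hx]
    simp [wmul, mul_add]
  have hd (t : ℝ) := (hω.hasDerivAt hσ hU t).sub (hω.hasDerivAt hσ hV t)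
  have hB : 0 ≤ B := (norm_nonneg _).trans (hBU t ht)
  have key := norm_le_mul_exp_of_norm_deriv_le (T := T)
    (K := 3 * √(3 * (invSqSum ^ 2 * A).toReal) * B ^ 2) (by positivity) hd ?_ ht
  · simpa only [Pi.sub_apply, ← hsub (hfU _) (hfV _) (hD _)] using key
  intro r hr
  have hXU := wsq_one_birkhoffForm_ne_top hσ N (hfU r) (hfU r) (hfU r)
  have hXV := wsq_one_birkhoffForm_ne_top hσ N (hfV r) (hfV r) (hfV r)
  have h1 := wsq_one_birkhoffForm_ne_top hσ N (hD r) (hfU r) (hfU r)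
  have h2 := wsq_one_birkhoffForm_ne_top hσ N (hfV r) (hD r) (hfU r)
  have h3 := wsq_one_birkhoffForm_ne_top hσ N (hfV r) (hfV r) (hD r)
  have hdec := hadd h1 h2 h3 (x := toEll (wmul ω (birkhoffForm σ N (U r) (U r) (U r)))
    - toEll (wmul ω (birkhoffForm σ N (V r) (V r) (V r)))) fun n => by
    rw [lp.coeFn_sub, Pi.sub_apply, toEll_apply (hω.wsq_one_wmul_ne_top hXU),
      toEll_apply (hω.wsq_one_wmul_ne_top hXV),
      ← birkhoffForm_sub hσ N (hfU r) (hfV r) (hD r)]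
    simp [wmul, mul_sub]
  rw [hdec, Pi.sub_apply, ← hsub (hfU r) (hfV r) (hD r)]
  have e1 := hω.norm_birkhoffForm_le hA hσ N (hD r) (hfU r) (hfU r)
  have e2 := hω.norm_birkhoffForm_le hA hσ N (hfV r) (hD r) (hfU r)
  have e3 := hω.norm_birkhoffForm_le hA hσ N (hfV r) (hfV r) (hD r)
  have hu := hBU r hr
  have hv := hBV r hr
  set κ := √(3 * (invSqSum ^ 2 * A).toReal)
  set δ := ‖toEll (wmul ω (U r - V r))‖
  calc _ ≤ _ := norm_add₃_le
    _ ≤ κ * (δ * B * B) + κ * (B * δ * B) + κ * (B * B * δ) := by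
      refine add_le_add (add_le_add (e1.trans ?_) (e2.trans ?_)) (e3.trans ?_) <;> gcongr
    _ = _ := by ring

/-! ### Truncated Sobolev weights -/

/-- The square root of the Sobolev weight `1 + |n|^{2s}` cut off at height `M`. -/
def sobolevWeight (s M : ℝ) (n : ℤ) : ℝ := √(min (1 + |(n : ℝ)| ^ (2 * s)) M)

lemma enorm_sobolevWeight_sq (s : ℝ) {M : ℝ} (hM : 0 ≤ M) (n : ℤ) :
    ‖sobolevWeight s M n‖ₑ ^ 2 = ENNReal.ofReal (min (1 + |(n : ℝ)| ^ (2 * s)) M) := by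
  rw [← ofReal_norm, ← ENNReal.ofReal_pow (norm_nonneg _), Real.norm_eq_abs, sq_abs,
    sobolevWeight, Real.sq_sqrt (by positivity)]

lemma one_add_rpow_le_of_le_three_mul {r x y : ℝ} (hr : 0 ≤ r) (hx : 0 ≤ x) (hy : 0 ≤ y)
    (h : x ≤ 3 * y) : 1 + x ^ r ≤ 3 ^ r * (1 + y ^ r) := by
  have h1 : (1 : ℝ) ≤ 3 ^ r := Real.one_le_rpow (by norm_num) hr
  have h2 : x ^ r ≤ 3 ^ r * y ^ r := by
    rw [← Real.mul_rpow (by norm_num) hy]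
    exact Real.rpow_le_rpow hx h hr
  linarith

lemma admissibleWeight_sobolevWeight {s M : ℝ} (hs : 0 ≤ s) (hM : 1 ≤ M) :
    AdmissibleWeight (sobolevWeight s M) (ENNReal.ofReal (3 ^ (2 * s))) where
  one_le n := by
    rw [enorm_sobolevWeight_sq s (by linarith), ENNReal.one_le_ofReal]
    exact le_min (le_add_of_nonneg_right (by positivity)) hM
  bounded := ⟨ENNReal.ofReal M, ENNReal.ofReal_ne_top, fun n => by
    rw [enorm_sobolevWeight_sq s (by linarith)]
    exact ENNReal.ofReal_le_ofReal (min_le_right _ _)⟩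
  subadditive j₁ j₂ n := by
    have hM0 : 0 ≤ M := by linarith
    have hA : (1 : ℝ) ≤ 3 ^ (2 * s) := Real.one_le_rpow (by norm_num) (by positivity)
    have hnn (j : ℤ) : 0 ≤ min (1 + |(j : ℝ)| ^ (2 * s)) M := by positivity
    simp only [enorm_sobolevWeight_sq s hM0]
    rw [← ENNReal.ofReal_add (hnn _) (hnn _),
      ← ENNReal.ofReal_add (add_nonneg (hnn _) (hnn _)) (hnn _),
      ← ENNReal.ofReal_mul (by positivity)]
    refine ENNReal.ofReal_le_ofReal ?_
    have hcmp {j : ℤ} (hj : |(n : ℝ)| ≤ 3 * |(j : ℝ)|) : min (1 + |(n : ℝ)| ^ (2 * s)) M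
        ≤ 3 ^ (2 * s) * min (1 + |(j : ℝ)| ^ (2 * s)) M := by
      rw [mul_min_of_nonneg _ _ (by positivity)]
      exact min_le_min (one_add_rpow_le_of_le_three_mul (by positivity) (abs_nonneg _)
        (abs_nonneg _) hj) (le_mul_of_one_le_left hM0 hA)
    have hlarge : |(n : ℝ)| ≤ 3 * |(j₁ : ℝ)| ∨ |(n : ℝ)| ≤ 3 * |(j₂ : ℝ)| ∨
        |(n : ℝ)| ≤ 3 * |((j₁ + j₂ - n : ℤ) : ℝ)| := by
      by_contra! hlt
      have h1 : (n : ℝ) = j₁ + j₂ - ((j₁ + j₂ - n : ℤ) : ℝ) := by push_cast; ring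
      have h2 : |(n : ℝ)| ≤ |(j₁ : ℝ)| + |(j₂ : ℝ)| + |((j₁ + j₂ - n : ℤ) : ℝ)| := by
        conv_lhs => rw [h1]
        exact (abs_sub _ _).trans (by gcongr; exact abs_add_le _ _)
      linarith [hlt.1, hlt.2.1, hlt.2.2]
    have e (j : ℤ) := mul_nonneg (zero_le_one.trans hA) (hnn j)
    rw [mul_add, mul_add]
    rcases hlarge with h | h | h <;>
      linarith [hcmp h, e j₁, e j₂, e (j₁ + j₂ - n)]

lemma hsE_sq (s : ℝ) (u : ℤ → ℂ) :
    hsE s u ^ 2 = wsq (fun n => ENNReal.ofReal (1 + |(n : ℝ)| ^ (2 * s))) u := by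
  rw [hsE, ← ENNReal.rpow_two, ← ENNReal.rpow_mul]
  norm_num
  rfl

lemma wsq_sobolevWeight_le (s : ℝ) {M : ℝ} (hM : 0 ≤ M) (u : ℤ → ℂ) :
    wsq (fun n => ‖sobolevWeight s M n‖ₑ ^ 2) u ≤ hsE s u ^ 2 := by
  rw [hsE_sq]
  refine ENNReal.tsum_le_tsum fun n => ?_
  simp only [enorm_sobolevWeight_sq s hM]
  gcongr
  exact min_le_left _ _

lemma hsE_sq_le_of_forall_sobolevWeight {s : ℝ} {u : ℤ → ℂ} {K : ℝ≥0∞}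
    (h : ∀ M : ℝ, 1 ≤ M → wsq (fun n => ‖sobolevWeight s M n‖ₑ ^ 2) u ≤ K) :
    hsE s u ^ 2 ≤ K := by
  rw [hsE_sq, wsq, ENNReal.tsum_eq_iSup_sum]
  refine iSup_le fun S => ?_
  set M : ℝ := 1 + ∑ n ∈ S, (1 + |(n : ℝ)| ^ (2 * s))
  have hM1 : 1 ≤ M := le_add_of_nonneg_right (Finset.sum_nonneg fun n _ => by positivity)
  refine le_trans ?_ (h M hM1)
  refine le_trans (Finset.sum_le_sum fun n hn => ?_) (ENNReal.sum_le_tsum S)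
  beta_reduce
  rw [enorm_sobolevWeight_sq s (zero_le_one.trans hM1), min_eq_left]
  have := Finset.single_le_sum (f := fun n : ℤ => 1 + |(n : ℝ)| ^ (2 * s))
    (fun n _ => by positivity) hn
  linarith

lemma wsq_one_sub_ne_top {u v : ℤ → ℂ} (hu : wsq 1 u ≠ ⊤) (hv : wsq 1 v ≠ ⊤) :
    wsq 1 (u - v) ≠ ⊤ := by
  have h := enorm_sq_lp (toEll u - toEll v)
  simp only [lp.coeFn_sub, Pi.sub_apply, toEll_apply hu, toEll_apply hv] at h
  rw [wsq_one]
  simp only [Pi.sub_apply]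
  rw [← h]
  exact ENNReal.pow_ne_top enorm_ne_top

lemma norm_toEll_wmul_sobolevWeight_le {s M R : ℝ} (hs : 0 ≤ s) (hM : 1 ≤ M) (hR : 0 ≤ R)
    {u : ℤ → ℂ} (hu : wsq 1 u ≠ ⊤) (h : hsE s u ≤ ENNReal.ofReal R) :
    ‖toEll (wmul (sobolevWeight s M) u)‖ ≤ R := by
  rw [← sq_le_sq₀ (norm_nonneg _) hR, ← ENNReal.ofReal_le_ofReal_iff (by positivity),
    (admissibleWeight_sobolevWeight hs hM).ofReal_norm_sq hu, ENNReal.ofReal_pow hR]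
  exact (wsq_sobolevWeight_le s (by linarith) u).trans (pow_le_pow_left' h 2)

/-- Lipschitz stability of the Birkhoff flow in `H^s` for `α = 1`, with a constant depending
only on `R`, `T`, `s`. -/
theorem statement_5 (s T R : ℝ) (hs : 0 ≤ s) (hT : 0 < T) (hR : 0 < R) :
    ∃ C : ℝ, 0 < C ∧ ∀ σ : ℝ, (σ = 1 ∨ σ = -1) → ∀ N : ℕ∞,
      ∀ v w : ℤ → ℂ, hsE s v ≤ ENNReal.ofReal R → hsE s w ≤ ENNReal.ofReal R →
      ∀ U V : ℝ → ℤ → ℂ,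
        IsSol 1 σ N 0 U → U 0 = v → IsSol 1 σ N 0 V → V 0 = w →
        ∀ t : ℝ, |t| ≤ T →
          hsE s (fun n => U t n - V t n)
            ≤ ENNReal.ofReal C * hsE s (fun n => v n - w n) := by
  set A : ℝ≥0∞ := ENNReal.ofReal (3 ^ (2 * s))
  have hA : A ≠ ⊤ := ENNReal.ofReal_ne_top
  set κ := √(3 * (invSqSum ^ 2 * A).toReal)
  set B := R * Real.exp (κ * R ^ 2 * T)
  refine ⟨Real.exp (3 * κ * B ^ 2 * T), Real.exp_pos _, ?_⟩
  intro σ hσ N v w hv hw U V hU hU0 hV hV0 t ht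
  subst hU0 hV0
  have hfU (t : ℝ) : wsq 1 (U t) ≠ ⊤ := wsq_one_ne_top_of_hsE (hU t).1
  have hfV (t : ℝ) : wsq 1 (V t) ≠ ⊤ := wsq_one_ne_top_of_hsE (hV t).1
  have hD (t : ℝ) : wsq 1 (U t - V t) ≠ ⊤ := wsq_one_sub_ne_top (hfU t) (hfV t)
  change hsE s (U t - V t) ≤ _ * hsE s (U 0 - V 0)
  rw [← ENNReal.pow_le_pow_left_iff two_ne_zero]
  refine hsE_sq_le_of_forall_sobolevWeight fun M hM => ?_
  have hω := admissibleWeight_sobolevWeight hs hM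
  have hlip := hω.norm_sol_sub_le hA hσ hU hV (B := B) (T := T)
    (fun r hr => hω.norm_sol_le hA hσ hU
      (norm_toEll_wmul_sobolevWeight_le hs hM hR.le (hfU 0) hv) hr)
    (fun r hr => hω.norm_sol_le hA hσ hV
      (norm_toEll_wmul_sobolevWeight_le hs hM hR.le (hfV 0) hw) hr) hD ht
  rw [← hω.ofReal_norm_sq (hD t)]
  calc _ ≤ ENNReal.ofReal ((‖toEll (wmul (sobolevWeight s M) (U 0 - V 0))‖ *
        Real.exp (3 * κ * B ^ 2 * T)) ^ 2) := by gcongr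
    _ = ENNReal.ofReal (Real.exp (3 * κ * B ^ 2 * T)) ^ 2 *
        wsq (fun n => ‖sobolevWeight s M n‖ₑ ^ 2) (U 0 - V 0) := by
      rw [mul_comm, mul_pow, ENNReal.ofReal_mul (by positivity), hω.ofReal_norm_sq (hD 0),
        ENNReal.ofReal_pow (by positivity)]
    _ ≤ _ := by
      rw [mul_pow (ENNReal.ofReal _)]
      gcongr
      exact wsq_sobolevWeight_le s (by linarith) _

end
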